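/- arXiv:2604.17347 — 3 statements merged into one kernel-verified Lean document; each statement's English description precedes it below -/
import Mathlib

section
/- For every goal G_i, every set Σ_i of strategies of agent i, and every set Σ_{-i} of profiles of the other agents' strategies: if ENF_i(G_i, Σ_{-i}) ∩ Σ_i ≠ ∅, then BE_i(G_i, Σ_{-i}) = ENF_i(G_i, Σ_{-i}) ∩ Σ_i; that is, when agent i has an available winning strategy, its best-effort strategies are exactly its available winning strategies. -/
/-!
Common setup: a finite alphabet `A` of propositional variables, partitioned into
a set `Z` controlled by the environment and sets `X i` controlled by agents
`i : Fin n`.  An instant is a subset of `A`, a trace is an infinite sequence of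
instants, a history is a finite sequence of instants.
-/

/-- A trace is an infinite sequence of instants (subsets of the atoms). -/
abbrev Trace (A : Type) := ℕ → Set A

/-- The first `k` instants of a trace `t`, i.e. the history `t[0..k-1]`. -/
def traceHist {A : Type} (t : Trace A) (k : ℕ) : List (Set A) :=
  (List.range k).map t

/-- The prefix-closure of a set of traces: all histories that are a finite
prefix of some trace in the set. -/
def Pref {A : Type} (T : Set (Trace A)) : Set (List (Set A)) :=
  { h | ∃ t ∈ T, h = traceHist t h.length }

/-- A strategy over a set `S` of controlled variables: from each history it
chooses a valuation of the variables in `S`, i.e. a subset of `S`. -/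
def Strat {A : Type} (S : Set A) := { f : List (Set A) → Set A // ∀ h, f h ⊆ S }

/-- An arena: the atoms `A` are partitioned into pairwise disjoint sets
`Z, X 0, …, X (n-1)`, where `X i` is controlled by agent `i` and `Z` by the
environment. -/
structure Arena (A : Type) (n : ℕ) where
  Z : Set A
  X : Fin n → Set A
  disjZX : ∀ i, Disjoint Z (X i)
  disjXX : ∀ i j, i ≠ j → Disjoint (X i) (X j)
  cover : Z ∪ (⋃ i, X i) = (Set.univ : Set A)

namespace Arena

variable {A : Type} {n : ℕ} (ar : Arena A n)

/-- A strategy profile: one strategy per agent. -/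
def Profile := ∀ i, Strat (ar.X i)

/-- A profile of strategies for all agents other than `i`. -/
def OProfile (i : Fin n) := ∀ j, j ≠ i → Strat (ar.X j)

/-- Combining a strategy of agent `i` with a profile for all other agents. -/
def combine (i : Fin n) (σi : Strat (ar.X i)) (σo : ar.OProfile i) : ar.Profile :=
  fun j => if h : j = i then h ▸ σi else σo j h

/-- The instant produced after history `h` by profile `σ` and environment `σe`. -/
def step (σ : ar.Profile) (σe : Strat ar.Z) (h : List (Set A)) : Set A :=
  σe.1 h ∪ ⋃ i, (σ i).1 h

/-- The history of the first `k` steps of the joint execution. -/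
def hist (σ : ar.Profile) (σe : Strat ar.Z) : ℕ → List (Set A)
  | 0 => []
  | k + 1 => hist σ σe k ++ [ar.step σ σe (hist σ σe k)]

/-- The play induced by a strategy profile and an environment strategy: the
unique trace in which at every step each participant follows its strategy. -/
def play (σ : ar.Profile) (σe : Strat ar.Z) : Trace A :=
  fun k => ar.step σ σe (ar.hist σ σe k)

/-- `⟦Γ⟧`: the environment strategies compliant with the process specification. -/
def EnvSem (Γ : Set (Trace A)) : Set (Strat ar.Z) :=
  { σe | ∀ σ : ar.Profile, ar.play σ σe ∈ Γ }

/-- `ENF(G)`: the strategy profiles enforcing goal `G` under specification `Γ`. -/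
def ENF (Γ G : Set (Trace A)) : Set ar.Profile :=
  { υ | ∀ σe ∈ ar.EnvSem Γ, ar.play υ σe ∈ G }

/-- `υ ≥_G υ'`: profile dominance. -/
def Dom (Γ G : Set (Trace A)) (υ υ' : ar.Profile) : Prop :=
  ∀ σe ∈ ar.EnvSem Γ, ar.play υ' σe ∈ G → ar.play υ σe ∈ G

/-- `υ >_G υ'`: strict profile dominance. -/
def StrictDom (Γ G : Set (Trace A)) (υ υ' : ar.Profile) : Prop :=
  ar.Dom Γ G υ υ' ∧ ¬ ar.Dom Γ G υ' υ

/-- `BE(G)`: best-effort (maximal) strategy profiles for goal `G`. -/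
def BE (Γ G : Set (Trace A)) : Set ar.Profile :=
  { υ | ¬ ∃ υ', ar.StrictDom Γ G υ' υ }

/-- `CNS(Σ)`: traces consistent with a set of strategy profiles. -/
def CNS (Γ : Set (Trace A)) (Ss : Set ar.Profile) : Set (Trace A) :=
  { t | ∃ υ ∈ Ss, ∃ σe ∈ ar.EnvSem Γ, t = ar.play υ σe }

/-- `ENF_i(G_i, Θ)`: strategies of agent `i` enforcing its goal `G_i` when the
other agents play within `Θ` and the environment within `⟦Γ⟧`. -/
def ENFi (Γ : Set (Trace A)) (i : Fin n) (Gi : Set (Trace A))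
    (Θ : Set (ar.OProfile i)) : Set (Strat (ar.X i)) :=
  { σi | ∀ σe ∈ ar.EnvSem Γ, ∀ σo ∈ Θ, ar.play (ar.combine i σi σo) σe ∈ Gi }

/-- Dominance between strategies of agent `i` for `G_i` under assumptions `Θ`. -/
def Domi (Γ : Set (Trace A)) (i : Fin n) (Gi : Set (Trace A))
    (Θ : Set (ar.OProfile i)) (σi σi' : Strat (ar.X i)) : Prop :=
  ∀ σo ∈ Θ, ∀ σe ∈ ar.EnvSem Γ,
    ar.play (ar.combine i σi' σo) σe ∈ Gi → ar.play (ar.combine i σi σo) σe ∈ Gi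

/-- Strict dominance between strategies of agent `i`. -/
def StrictDomi (Γ : Set (Trace A)) (i : Fin n) (Gi : Set (Trace A))
    (Θ : Set (ar.OProfile i)) (σi σi' : Strat (ar.X i)) : Prop :=
  ar.Domi Γ i Gi Θ σi σi' ∧ ¬ ar.Domi Γ i Gi Θ σi' σi

/-- `BE_i(G_i, Θ)` relative to the available strategies `Σi` of agent `i`. -/
def BEi (Γ : Set (Trace A)) (i : Fin n) (Gi : Set (Trace A))
    (Θ : Set (ar.OProfile i)) (Si : Set (Strat (ar.X i))) : Set (Strat (ar.X i)) :=
  { σi | σi ∈ Si ∧ ¬ ∃ σi' ∈ Si, ar.StrictDomi Γ i Gi Θ σi' σi }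

/-- `CNS_i(Σi)`: traces consistent with some strategy of agent `i` in `Σi`. -/
def CNSi (Γ : Set (Trace A)) (i : Fin n) (Si : Set (Strat (ar.X i))) :
    Set (Trace A) :=
  { t | ∃ σi ∈ Si, ∃ σo : ar.OProfile i, ∃ σe ∈ ar.EnvSem Γ,
      t = ar.play (ar.combine i σi σo) σe }

/-- `CNS_{-i}(Θ)`: traces consistent with some profile of the other agents
allowed by the assumption `Θ`. -/
def CNSmi (Γ : Set (Trace A)) (i : Fin n) (Θ : Set (ar.OProfile i)) :
    Set (Trace A) :=
  { t | ∃ σi : Strat (ar.X i), ∃ σo ∈ Θ, ∃ σe ∈ ar.EnvSem Γ,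
      t = ar.play (ar.combine i σi σo) σe }

end Arena

/-- If agent `i` has an available winning strategy, then its
best-effort strategies are exactly its available winning strategies:
`ENF_i(G_i, Σ_{-i}) ∩ Σ_i ≠ ∅ → BE_i(G_i, Σ_{-i}) = ENF_i(G_i, Σ_{-i}) ∩ Σ_i`. -/
theorem bei_eq_enfi_of_nonempty {A : Type} {n : ℕ} (ar : Arena A n)
    (Γ : Set (Trace A)) (i : Fin n) (Gi : Set (Trace A))
    (Θ : Set (ar.OProfile i)) (Si : Set (Strat (ar.X i)))
    (hne : ar.ENFi Γ i Gi Θ ∩ Si ≠ ∅) :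
    ar.BEi Γ i Gi Θ Si = ar.ENFi Γ i Gi Θ ∩ Si := by
  obtain ⟨w, hw, hwS⟩ := Set.nonempty_iff_ne_empty.mpr hne
  ext s
  constructor
  · rintro ⟨hs, hmax⟩
    refine ⟨?_, hs⟩
    by_contra hns
    refine hmax ⟨w, hwS, fun σo ho σe he _ => hw σe he σo ho, fun hd => hns ?_⟩
    exact fun σe he σo ho => hd σo ho σe he (hw σe he σo ho)
  · rintro ⟨hE, hs⟩
    refine ⟨hs, ?_⟩
    rintro ⟨s', _, _, hnd⟩
    exact hnd (fun σo ho σe he _ => hE σe he σo ho)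
end

section
/- Assumption compilation: for every goal G_i of agent i, every process specification Γ, and every set Θ of profiles of the other agents' strategies, ENF_i(G_i, Θ) = ENF_i((CNS_{-i}(Θ))^c ∪ G_i), where the right-hand side denotes the set of strategies of agent i that enforce the implication goal 'if the trace lies in CNS_{-i}(Θ) then it lies in G_i' against ALL profiles of the other agents' strategies. -/
theorem mem_step_combine {A : Type} {n : ℕ} (ar : Arena A n) (i : Fin n)
    (σi : Strat (ar.X i)) (σo : ar.OProfile i) (σe : Strat ar.Z) (h : List (Set A)) (x : A) :
    x ∈ ar.step (ar.combine i σi σo) σe h ↔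
      x ∈ σe.1 h ∨ x ∈ σi.1 h ∨ ∃ j, ∃ hj : j ≠ i, x ∈ (σo j hj).1 h := by
  simp only [Arena.step, Set.mem_union, Set.mem_iUnion]
  refine or_congr Iff.rfl ⟨?_, ?_⟩
  · rintro ⟨j, hx⟩
    by_cases hj : j = i
    · subst hj
      left
      simpa [Arena.combine] using hx
    · right
      exact ⟨j, hj, by simpa [Arena.combine, hj] using hx⟩
  · rintro (hx | ⟨j, hj, hx⟩)
    · exact ⟨i, by simpa [Arena.combine] using hx⟩
    · exact ⟨j, by simpa [Arena.combine, hj] using hx⟩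

theorem step_combine_inter {A : Type} {n : ℕ} (ar : Arena A n) (i : Fin n)
    (σi : Strat (ar.X i)) (σo : ar.OProfile i) (σe : Strat ar.Z) (h : List (Set A)) :
    ar.step (ar.combine i σi σo) σe h ∩ ar.X i = σi.1 h := by
  ext x
  rw [Set.mem_inter_iff, mem_step_combine]
  constructor
  · rintro ⟨hx | hx | ⟨j, hj, hx⟩, hX⟩
    · exact (Set.disjoint_left.1 (ar.disjZX i) (σe.2 h hx) hX).elim
    · exact hx
    · exact (Set.disjoint_left.1 (ar.disjXX j i hj) ((σo j hj).2 h hx) hX).elim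
  · intro hx
    exact ⟨Or.inr (Or.inl hx), σi.2 h hx⟩

theorem hist_eq_traceHist {A : Type} {n : ℕ} (ar : Arena A n) (σ : ar.Profile)
    (σe : Strat ar.Z) (k : ℕ) : ar.hist σ σe k = traceHist (ar.play σ σe) k := by
  induction k with
  | zero => rfl
  | succ k ih =>
    have h : ar.hist σ σe (k + 1) = ar.hist σ σe k ++ [ar.play σ σe k] := rfl
    rw [h, ih]
    simp [traceHist, List.range_succ]

/-- If two plays coincide, agent `i` may swap its strategy in the second for that of the first. -/
theorem play_swap {A : Type} {n : ℕ} (ar : Arena A n) (i : Fin n)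
    (σi σi' : Strat (ar.X i)) (σo σo' : ar.OProfile i) (σe σe' : Strat ar.Z)
    (heq : ar.play (ar.combine i σi σo) σe = ar.play (ar.combine i σi' σo') σe') :
    ar.play (ar.combine i σi σo') σe' = ar.play (ar.combine i σi' σo') σe' := by
  have hh : ∀ k, ar.hist (ar.combine i σi σo) σe k = ar.hist (ar.combine i σi' σo') σe' k := by
    intro k
    rw [hist_eq_traceHist, hist_eq_traceHist, heq]
  have hstep : ∀ k, ar.step (ar.combine i σi σo') σe' (ar.hist (ar.combine i σi' σo') σe' k) =
      ar.step (ar.combine i σi' σo') σe' (ar.hist (ar.combine i σi' σo') σe' k) := by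
    intro k
    have h1 : ar.step (ar.combine i σi σo) σe (ar.hist (ar.combine i σi σo) σe k) =
      ar.step (ar.combine i σi' σo') σe' (ar.hist (ar.combine i σi' σo') σe' k) := congrFun heq k
    have h2 := step_combine_inter ar i σi σo σe (ar.hist (ar.combine i σi σo) σe k)
    rw [h1, step_combine_inter, hh k] at h2
    ext x
    rw [mem_step_combine, mem_step_combine, h2]
  have hist_eq : ∀ k, ar.hist (ar.combine i σi σo') σe' k =
      ar.hist (ar.combine i σi' σo') σe' k := by
    intro k
    induction k with
    | zero => rfl
    | succ k ih => rw [Arena.hist, Arena.hist, ih, hstep]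
  funext k
  rw [Arena.play, Arena.play, hist_eq, hstep]

/-- Assumption compilation: enforcing `G_i` under the
assumption `Θ` on the other agents is the same as enforcing the implication
goal `CNS_{-i}(Θ) ⇒ G_i` (i.e. the goal `(CNS_{-i}(Θ))ᶜ ∪ G_i`) against all
profiles of the other agents:
`ENF_i(G_i, Θ) = ENF_i((CNS_{-i}(Θ))ᶜ ∪ G_i)`. -/
theorem enfi_assumption_compilation {A : Type} {n : ℕ} (ar : Arena A n)
    (Γ : Set (Trace A)) (i : Fin n) (Gi : Set (Trace A))
    (Θ : Set (ar.OProfile i)) :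
    ar.ENFi Γ i Gi Θ =
      ar.ENFi Γ i ((ar.CNSmi Γ i Θ)ᶜ ∪ Gi) Set.univ := by
  ext σi
  constructor
  · intro h σe _ σo _
    by_cases ht : ar.play (ar.combine i σi σo) σe ∈ ar.CNSmi Γ i Θ
    · right
      obtain ⟨σi', σo', ho', σe', he', heq⟩ := ht
      rw [heq, ← play_swap ar i σi σi' σo σo' σe σe' heq]
      exact h σe' he' σo' ho'
    · exact Or.inl ht
  · intro h σe he σo ho
    rcases h σe he σo (Set.mem_univ _) with hc | hg
    · exact (hc ⟨σi, σo, ho, σe, he, rfl⟩).elim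
    · exact hg
end

section
/- Best-effort does not imply winning: there exists an agentic process with a single agent in which the agent has a nonempty set of best-effort strategies but no winning strategy. Concretely, let 𝔄 = {z, x} with Z = {z} and X_1 = {x}, let Γ be the set of all traces (so ⟦Γ⟧ contains all environment strategies), let Σ_1 be the set of all strategies of agent 1, and let G_1 be the set of traces in which z holds at some position. Then ENF_1(G_1) = ∅, while every strategy of agent 1 is best-effort for G_1, so BE_1(G_1) ≠ ∅. -/
/-- The concrete single-agent arena of Statement 18: atoms `𝔄 = {z, x}` with
`z = 0` controlled by the environment and `x = 1` controlled by agent `1`. -/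
def exArena : Arena (Fin 2) 1 where
  Z := {0}
  X := fun _ => {1}
  disjZX := fun _ => by
    rw [Set.disjoint_singleton]
    decide
  disjXX := fun i j hij => absurd (Subsingleton.elim i j) hij
  cover := by
    ext a
    fin_cases a <;> simp

/-- The goal of Statement 18: `z` (i.e. `0`) eventually holds. -/
def exGoal : Set (Trace (Fin 2)) := { t | ∃ k : ℕ, (0 : Fin 2) ∈ t k }

theorem ex_mem_play (τ : exArena.Profile) (e : Strat exArena.Z) (k : ℕ) :
    (0 : Fin 2) ∈ exArena.play τ e k ↔ (0 : Fin 2) ∈ e.1 (exArena.hist τ e k) := by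
  constructor
  · rintro (h | h)
    · exact h
    · obtain ⟨i, hi⟩ := Set.mem_iUnion.1 h
      have h1 : (0 : Fin 2) ∈ ({1} : Set (Fin 2)) := (τ i).2 _ hi
      simp at h1
  · exact fun h => Or.inl h

theorem ex_env_empty (e : Strat exArena.Z) (h : List (Set (Fin 2)))
    (h0 : (0 : Fin 2) ∉ e.1 h) : e.1 h = ∅ := by
  apply Set.eq_empty_iff_forall_notMem.2
  intro a ha
  have h1 : a ∈ ({0} : Set (Fin 2)) := e.2 h ha
  rw [Set.mem_singleton_iff] at h1
  subst h1
  exact h0 ha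

theorem ex_hist_length (τ : exArena.Profile) (e : Strat exArena.Z) (k : ℕ) :
    (exArena.hist τ e k).length = k := by
  induction k with
  | zero => rfl
  | succ k ih => simp [Arena.hist, ih]

theorem ex_hist_eq (τ : exArena.Profile) (e e' : Strat exArena.Z) (k : ℕ)
    (h1 : ∀ j < k, (0 : Fin 2) ∉ e.1 (exArena.hist τ e j))
    (h2 : ∀ j < k, (0 : Fin 2) ∉ e'.1 (exArena.hist τ e j)) :
    exArena.hist τ e' k = exArena.hist τ e k := by
  induction k with
  | zero => rfl
  | succ k ih =>
    have ih' := ih (fun j hj => h1 j (by omega)) (fun j hj => h2 j (by omega))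
    simp only [Arena.hist, ih', Arena.step]
    rw [ex_env_empty e _ (h1 k (by omega)), ex_env_empty e' _ (h2 k (by omega))]

/-- The environment strategy playing `z` exactly after history `H`. -/
def exEnv (H : List (Set (Fin 2))) : Strat exArena.Z :=
  ⟨fun h => {a | a = 0 ∧ h = H}, fun _ _ ha => ha.1⟩

theorem ex_no_dom (τ τ' : exArena.Profile) (e : Strat exArena.Z)
    (hd : ∀ e : Strat exArena.Z, exArena.play τ e ∈ exGoal → exArena.play τ' e ∈ exGoal)
    (hw : exArena.play τ' e ∈ exGoal) : exArena.play τ e ∈ exGoal := by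
  classical
  by_contra hl
  have hl' : ∀ j, (0 : Fin 2) ∉ e.1 (exArena.hist τ e j) :=
    fun j hj => hl ⟨j, (ex_mem_play τ e j).2 hj⟩
  have hex : ∃ k, (0 : Fin 2) ∈ exArena.play τ' e k := hw
  obtain ⟨k, hk, hmin⟩ : ∃ k, (0 : Fin 2) ∈ exArena.play τ' e k ∧
      ∀ j < k, (0 : Fin 2) ∉ exArena.play τ' e j :=
    ⟨Nat.find hex, Nat.find_spec hex, fun j hj => Nat.find_min hex hj⟩
  have hne : ∀ (ρ : exArena.Profile), ∀ j < k,
      (0 : Fin 2) ∉ (exEnv (exArena.hist τ e k)).1 (exArena.hist ρ e j) := by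
    rintro ρ j hj ⟨-, h⟩
    have := congrArg List.length h
    rw [ex_hist_length, ex_hist_length] at this
    omega
  have hwin : exArena.play τ (exEnv (exArena.hist τ e k)) ∈ exGoal := by
    refine ⟨k, (ex_mem_play _ _ _).2 ⟨rfl, ?_⟩⟩
    exact ex_hist_eq τ e _ k (fun j _ => hl' j) (hne τ)
  obtain ⟨m, hm⟩ := hd _ hwin
  obtain ⟨-, hm⟩ := (ex_mem_play _ _ _).1 hm
  have hmk := congrArg List.length hm
  rw [ex_hist_length, ex_hist_length] at hmk
  subst hmk
  rw [ex_hist_eq τ' e _ m (fun j hj h => hmin j hj ((ex_mem_play _ _ _).2 h)) (hne τ')] at hm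
  apply hl' m
  rw [← hm]
  exact (ex_mem_play _ _ _).1 hk

/-- Best effort does not imply winning: in the single-agent
process with `Γ` the set of all traces, `Σ_1` all strategies, and goal
"eventually `z`", the agent has no winning strategy (`ENF_1(G_1) = ∅`), yet
every strategy is best-effort, so `BE_1(G_1) ≠ ∅`. -/
theorem bestEffort_not_winning :
    exArena.ENFi Set.univ 0 exGoal Set.univ = ∅ ∧
    exArena.BEi Set.univ 0 exGoal Set.univ Set.univ = Set.univ ∧
    exArena.BEi Set.univ 0 exGoal Set.univ Set.univ ≠ ∅ := by
  have hBE : exArena.BEi Set.univ 0 exGoal Set.univ Set.univ = Set.univ := by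
    apply Set.eq_univ_of_forall
    intro σ
    refine ⟨trivial, ?_⟩
    rintro ⟨σ', -, hd, hn⟩
    apply hn
    intro σo _ e _ hw
    exact ex_no_dom _ _ e (fun e' h => hd σo trivial e' (fun _ => trivial) h) hw
  refine ⟨?_, hBE, ?_⟩
  · apply Set.eq_empty_iff_forall_notMem.2
    intro σ hσ
    obtain ⟨k, hk⟩ := hσ ⟨fun _ => ∅, fun _ => Set.empty_subset _⟩ (fun _ => trivial)
      (fun j hj => absurd (Subsingleton.elim j 0) hj) trivial
    exact (ex_mem_play _ _ _).1 hk
  · rw [hBE]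
    intro h
    have h1 : (⟨fun _ => ∅, fun _ => Set.empty_subset _⟩ : Strat (exArena.X 0)) ∈
      (Set.univ : Set (Strat (exArena.X 0))) := trivial
    rw [h] at h1
    exact h1
end
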